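/- arXiv:1912.10943 — 3 statements merged into one kernel-verified Lean document; each statement's English description precedes it below -/
import Mathlib

section
/- Let r be a positive integer and n ≤ m natural numbers; set a = n mod r, h = (m−n) mod r, and γ = a·h if a + h ≤ r and γ = (r−a)·(r−h) otherwise. Then there exist functions A, B : Fin r → ℕ with B_i ≤ A_i for all i such that {m}_r! · φ_r( ∏_{i} {B_i}! · {A_i − B_i}! ) = s_1^{γ} · φ_r( ∏_{i} {A_i}! ) · {n}_r! · {m−n}_r!. (Equivalently, the r-Lucanomial {m}_r!/({n}_r!·{m−n}_r!) equals s_1^{γ} times the image under φ_r of a product of r Lucanomials.) -/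
open MvPolynomial Finset

/-- The Lucas polynomials in `ℤ[S]`, where `s₁ = X 1` and `s₂ = X 2`. -/
noncomputable def luc : ℕ → MvPolynomial ℕ ℤ
  | 0 => 0
  | 1 => 1
  | m + 2 => X 1 * luc (m + 1) + X 2 * luc m

/-- The Lucas factorial `{m}! = {m}·{m−1}⋯{1}`, with `{0}! = 1`. -/
noncomputable def lucFact (m : ℕ) : MvPolynomial ℕ ℤ :=
  ∏ j ∈ Finset.range m, luc (j + 1)

/-- `φ_r`, the `ℤ`-algebra endomorphism of `ℤ[S]` sending each variable `s_i` to `s_{r·i}`. -/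
noncomputable def phi (r : ℕ) : MvPolynomial ℕ ℤ →ₐ[ℤ] MvPolynomial ℕ ℤ :=
  aeval fun i => X (r * i)

/-- Products over a full residue system are invariant under translation. -/
theorem prod_range_add_mod {M : Type*} [CommMonoid M] (r n : ℕ) (g : ℕ → M) :
    ∏ i ∈ range r, g ((n + i) % r) = ∏ i ∈ range r, g i := by
  induction n with
  | zero =>
    refine prod_congr rfl fun i hi => ?_
    rw [zero_add, Nat.mod_eq_of_lt (mem_range.mp hi)]
  | succ n ih =>
    rw [← ih]
    cases r with
    | zero => simp
    | succ r =>
      rw [prod_range_succ, prod_range_succ' _ r]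
      congr 1
      · refine prod_congr rfl fun i _ => ?_
        congr 2; ring
      · rw [add_assoc, add_comm 1 r, Nat.add_mod_right, add_zero]

/-- Grouping the factors `{⌊k/r⌋ + 1}` by residue class modulo `r` gives Lucas factorials. -/
theorem prod_luc_div (r : ℕ) (hr : 0 < r) (m : ℕ) :
    ∏ k ∈ range m, luc (k / r + 1) = ∏ i ∈ range r, lucFact ((m + i) / r) := by
  induction m with
  | zero =>
    refine (prod_eq_one fun i hi => ?_).symm
    rw [zero_add, Nat.div_eq_of_lt (mem_range.mp hi)]
    simp [lucFact]
  | succ m ih =>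
    obtain ⟨r, rfl⟩ := Nat.exists_eq_succ_of_ne_zero hr.ne'
    rw [prod_range_succ, ih, prod_range_succ', prod_range_succ _ r]
    have hshift : m + 1 + r = m + (r + 1) := by ring
    rw [hshift, Nat.add_div_right _ hr, add_zero, lucFact, lucFact, prod_range_succ _ (m / _),
      mul_assoc]
    congr 1
    refine prod_congr rfl fun i _ => ?_
    rw [add_assoc m 1 i, add_comm 1 i]

theorem two_mul_sum_range_mod (r : ℕ) (hr : 0 < r) (n : ℕ) :
    (2 * (∑ k ∈ range n, k % r : ℕ) : ℤ)
      = (n / r : ℕ) * (r * (r - 1)) + (n % r : ℕ) * ((n % r : ℕ) - 1) := by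
  induction n with
  | zero => simp
  | succ n ih =>
    rw [sum_range_succ, Nat.cast_add, mul_add, ih]
    have hdm := Nat.div_add_mod n r
    rcases (Nat.succ_le_of_lt (Nat.mod_lt n hr)).lt_or_eq with h | h
    · obtain ⟨h₁, h₂⟩ : (n + 1) / r = n / r ∧ (n + 1) % r = n % r + 1 :=
        (Nat.div_mod_unique hr).mpr ⟨by omega, h⟩
      rw [h₁, h₂]; push_cast; ring
    · obtain ⟨h₁, h₂⟩ : (n + 1) / r = n / r + 1 ∧ (n + 1) % r = 0 :=
        (Nat.div_mod_unique hr).mpr ⟨by rw [mul_add]; omega, hr⟩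
      have hcast : ((n % r : ℕ) : ℤ) = r - 1 := by omega
      rw [h₁, h₂, hcast]; push_cast; ring

theorem sum_range_add_mod (r : ℕ) (hr : 0 < r) (n l : ℕ) :
    ∑ k ∈ range (n + l), k % r
      = (if n % r + l % r ≤ r then (n % r) * (l % r) else (r - n % r) * (r - l % r))
        + ∑ k ∈ range n, k % r + ∑ k ∈ range l, k % r := by
  have hn := two_mul_sum_range_mod r hr n
  have hl := two_mul_sum_range_mod r hr l
  have hnl := two_mul_sum_range_mod r hr (n + l)
  have hnr := Nat.mod_lt n hr
  have hlr := Nat.mod_lt l hr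
  have hdn := Nat.div_add_mod n r
  have hdl := Nat.div_add_mod l r
  rcases lt_or_ge (n % r + l % r) r with h | h
  · obtain ⟨h₁, h₂⟩ : (n + l) / r = n / r + l / r ∧ (n + l) % r = n % r + l % r :=
      (Nat.div_mod_unique hr).mpr ⟨by rw [mul_add]; omega, h⟩
    rw [h₁, h₂] at hnl
    rw [if_pos h.le]
    zify
    push_cast at *
    linarith
  · obtain ⟨h₁, h₂⟩ : (n + l) / r = n / r + l / r + 1 ∧ (n + l) % r = n % r + l % r - r :=
      (Nat.div_mod_unique hr).mpr ⟨by rw [mul_add, mul_add]; omega, by omega⟩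
    rw [h₁, h₂, Nat.cast_sub h] at hnl
    rcases h.eq_or_lt with h' | h'
    · rw [if_pos h'.ge]
      have hcast : (r : ℤ) = (n % r : ℕ) + (l % r : ℕ) := by exact_mod_cast h'
      generalize n % r = a at *
      generalize l % r = b at *
      subst h'
      zify
      push_cast at *
      linarith
    · rw [if_neg (not_le.mpr h')]
      zify [hnr.le, hlr.le]
      push_cast at *
      linarith

theorem phi_luc_add_two (r k : ℕ) :
    phi r (luc (k + 2)) = X r * phi r (luc (k + 1)) + X (2 * r) * phi r (luc k) := by
  simp [luc, phi, mul_comm r 2]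

section RLucas

variable {r : ℕ} {L : ℕ → MvPolynomial ℕ ℤ}

/-- The `r`-Lucas polynomials in terms of Lucas polynomials. -/
theorem rLucas_eq (hL0 : L 0 = 0)
    (hL1 : ∀ i, 1 ≤ i → i ≤ r → L i = X 1 ^ (i - 1))
    (hLrec : ∀ k, r < k → L k = X r * L (k - r) + X (2 * r) * L (k - 2 * r))
    {i : ℕ} (hi : i < r) (q : ℕ) :
    L (r * q + i + 1) = X 1 ^ i * phi r (luc (q + 1)) := by
  induction q using Nat.twoStepInduction with
  | zero => simp [hL1 (i + 1) (by omega) hi, luc]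
  | one =>
    have h₁ : r * 1 + i + 1 - r = i + 1 := by omega
    have h₂ : r * 1 + i + 1 - 2 * r = 0 := by omega
    rw [hLrec _ (by omega), h₁, h₂, hL0, hL1 (i + 1) (by omega) hi, phi_luc_add_two]
    simp [luc, mul_comm]
  | more q ih₀ ih₁ =>
    have h₁ : r * (q + 2) + i + 1 - r = r * (q + 1) + i + 1 := by rw [mul_add, mul_add]; omega
    have h₂ : r * (q + 2) + i + 1 - 2 * r = r * q + i + 1 := by rw [mul_add]; omega
    rw [hLrec _ (by rw [mul_add]; omega), h₁, h₂, ih₀, ih₁, phi_luc_add_two r (q + 1)]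
    ring

/-- The `r`-Lucas factorial as a power of `s₁` times an image under `φ_r`. -/
theorem rLucas_factorial_eq (hr : 0 < r) (hL0 : L 0 = 0)
    (hL1 : ∀ i, 1 ≤ i → i ≤ r → L i = X 1 ^ (i - 1))
    (hLrec : ∀ k, r < k → L k = X r * L (k - r) + X (2 * r) * L (k - 2 * r)) (m : ℕ) :
    ∏ j ∈ range m, L (j + 1)
      = X 1 ^ (∑ k ∈ range m, k % r) * phi r (∏ i ∈ range r, lucFact ((m + i) / r)) := by
  rw [← prod_luc_div r hr, map_prod, ← prod_pow_eq_pow_sum, ← prod_mul_distrib]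
  refine prod_congr rfl fun k _ => ?_
  rw [← rLucas_eq hL0 hL1 hLrec (Nat.mod_lt k hr), Nat.div_add_mod]

end RLucas

/-- The `r`-Lucanomial `{m}_r!/({n}_r!·{m−n}_r!)` equals `s₁^γ` times the image under `φ_r`
of a product of `r` Lucanomials `∏_i {A_i}!/({B_i}!·{A_i−B_i}!)`, where `γ = γ_r(m,n)`. -/
theorem rLucanomial_eq_phi_of_lucanomials (r : ℕ) (hr : 0 < r) (m n : ℕ) (hnm : n ≤ m)
    (L : ℕ → MvPolynomial ℕ ℤ)
    (hL0 : L 0 = 0)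
    (hL1 : ∀ i, 1 ≤ i → i ≤ r → L i = X 1 ^ (i - 1))
    (hLrec : ∀ k, r < k → L k = X r * L (k - r) + X (2 * r) * L (k - 2 * r)) :
    ∃ A B : Fin r → ℕ, (∀ i, B i ≤ A i) ∧
      (∏ j ∈ Finset.range m, L (j + 1))
          * phi r (∏ i : Fin r, lucFact (B i) * lucFact (A i - B i))
        = X 1 ^ (if n % r + (m - n) % r ≤ r then (n % r) * ((m - n) % r)
              else (r - n % r) * (r - (m - n) % r))
          * phi r (∏ i : Fin r, lucFact (A i))
          * (∏ j ∈ Finset.range n, L (j + 1))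
          * (∏ j ∈ Finset.range (m - n), L (j + 1)) := by
  obtain ⟨l, rfl⟩ := Nat.exists_eq_add_of_le hnm
  have hdiv (i : ℕ) : (n + l + i) / r = (n + i) / r + (l + (n + i) % r) / r := by
    conv_lhs => rw [show n + l + i = l + (n + i) % r + r * ((n + i) / r) by
      have := Nat.mod_add_div (n + i) r; omega]
    rw [Nat.add_mul_div_left _ _ hr, add_comm]
  refine ⟨fun i => (n + l + i) / r, fun i => (n + i) / r, fun i => ?_, ?_⟩
  · simp only [hdiv, Nat.le_add_right]
  have hBC : ∏ i : Fin r, lucFact ((n + i) / r) * lucFact ((n + l + i) / r - (n + i) / r)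
      = (∏ i ∈ range r, lucFact ((n + i) / r)) * ∏ i ∈ range r, lucFact ((l + i) / r) := by
    rw [← prod_range_add_mod r n fun i => lucFact ((l + i) / r), ← prod_mul_distrib, prod_range]
    simp only [hdiv, Nat.add_sub_cancel_left]
  simp only [hBC, rLucas_factorial_eq hr hL0 hL1 hLrec, Nat.add_sub_cancel_left]
  rw [← prod_range fun i => lucFact ((n + l + i) / r), sum_range_add_mod r hr n l, map_mul,
    pow_add, pow_add]
  ring
end

section
/- Let r be a positive integer and m a natural number with 2·(m mod r) < r. Then {m+1}_r · {m}_r! · {m}_r! divides {2m}_r! in the polynomial ring ℤ[S]; that is, the r-Catalan analogue Cat_r(m) = (1/{m+1}_r)·{2m}_r!/({m}_r!·{m}_r!) is a polynomial. -/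
open MvPolynomial Finset

section Lucas

variable {R : Type*} [CommRing R]

/-- The Lucas sequence `F 0 = 0`, `F 1 = 1`, `F (n + 2) = s * F (n + 1) + t * F n`. -/
def lucasSeq (s t : R) : ℕ → R
  | 0 => 0
  | 1 => 1
  | n + 2 => s * lucasSeq s t (n + 1) + t * lucasSeq s t n

/-- The Lucas factorial `F 1 * ⋯ * F n`. -/
def lucasFactorial (s t : R) (n : ℕ) : R :=
  ∏ j ∈ range n, lucasSeq s t (j + 1)

lemma lucasFactorial_succ (s t : R) (n : ℕ) :
    lucasFactorial s t (n + 1) = lucasFactorial s t n * lucasSeq s t (n + 1) :=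
  prod_range_succ _ _

lemma lucasSeq_add_add_one (s t : R) (m n : ℕ) :
    lucasSeq s t (m + n + 1) =
      lucasSeq s t (m + 1) * lucasSeq s t (n + 1) + t * lucasSeq s t m * lucasSeq s t n := by
  induction n generalizing m with
  | zero => simp [lucasSeq]
  | succ n ih =>
    have h := ih (m + 1)
    rw [show m + (n + 1) + 1 = m + 1 + n + 1 by ring, h]
    simp only [lucasSeq]
    ring

lemma lucasFactorial_mul_dvd (s t : R) (a b : ℕ) :
    lucasFactorial s t a * lucasFactorial s t b ∣ lucasFactorial s t (a + b) := by
  induction a generalizing b with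
  | zero => simp [lucasFactorial]
  | succ a iha =>
    induction b with
    | zero => simp [lucasFactorial]
    | succ b ihb =>
      have ha := iha (b + 1)
      rw [show a + 1 + (b + 1) = a + 1 + b + 1 by ring, lucasFactorial_succ s t (a + 1 + b),
        show a + 1 + b + 1 = (a + 1) + b + 1 by ring, lucasSeq_add_add_one, mul_add]
      rw [show a + (b + 1) = a + 1 + b by ring] at ha
      refine dvd_add ?_ ?_
      · obtain ⟨c, hc⟩ := ihb
        rw [hc, lucasFactorial_succ s t b]
        exact ⟨c * lucasSeq s t (a + 1 + 1), by ring⟩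
      · obtain ⟨c, hc⟩ := ha
        rw [hc, lucasFactorial_succ s t a]
        exact ⟨c * t * lucasSeq s t b, by ring⟩

/-- The Lucas analogue of the Catalan numbers is integral. -/
lemma lucasSeq_mul_lucasFactorial_sq_dvd (s t : R) (n : ℕ) :
    lucasSeq s t (n + 1) * lucasFactorial s t n ^ 2 ∣ lucasFactorial s t (2 * n) := by
  rcases n with _ | n
  · simp [lucasFactorial, lucasSeq]
  rw [show 2 * (n + 1) = (n + 1 + n) + 1 by ring, lucasFactorial_succ s t (n + 1 + n),
    lucasSeq_add_add_one s t (n + 1) n, mul_add]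
  refine dvd_add ?_ ?_
  · obtain ⟨c, hc⟩ := lucasFactorial_mul_dvd s t (n + 1) n
    rw [hc, lucasFactorial_succ s t n]
    exact ⟨c, by ring⟩
  · rcases n with _ | n
    · simp [lucasSeq]
    · obtain ⟨c, hc⟩ := lucasFactorial_mul_dvd s t (n + 1 + 1 + 1) n
      rw [show n + 1 + 1 + (n + 1) = n + 1 + 1 + 1 + n by ring, hc]
      simp only [lucasFactorial_succ]
      exact ⟨c * t, by ring⟩

end Lucas

lemma prod_range_mod_mul_div {M : Type*} [CommMonoid M] (f g : ℕ → M) {r : ℕ} (q : ℕ) {t : ℕ}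
    (ht : t ≤ r) :
    ∏ j ∈ range (q * r + t), f (j % r) * g (j / r) =
      (∏ i ∈ range r, f i) ^ q * (∏ i ∈ range t, f i) *
        ((∏ k ∈ range q, g k) ^ r * g q ^ t) := by
  have block (q t : ℕ) (ht : t ≤ r) :
      ∏ i ∈ range t, f ((q * r + i) % r) * g ((q * r + i) / r) =
        (∏ i ∈ range t, f i) * g q ^ t := by
    rw [prod_mul_distrib]
    congr 1
    · refine prod_congr rfl fun i hi => ?_
      rw [mul_comm, Nat.mul_add_mod, Nat.mod_eq_of_lt ((mem_range.1 hi).trans_le ht)]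
    · rw [prod_congr rfl (g := fun _ => g q), prod_const, card_range]
      intro i hi
      have hi' : i < r := (mem_range.1 hi).trans_le ht
      rw [mul_comm, Nat.mul_add_div (by omega), Nat.div_eq_of_lt hi', add_zero]
  have full (q : ℕ) : ∏ j ∈ range (q * r), f (j % r) * g (j / r) =
      (∏ i ∈ range r, f i) ^ q * (∏ k ∈ range q, g k) ^ r := by
    induction q with
    | zero => simp
    | succ q ih =>
      rw [add_mul, one_mul, prod_range_add, ih, block q r le_rfl, prod_range_succ g, mul_pow,
        pow_succ]
      ac_rfl
  rw [prod_range_add, full, block q t ht]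
  ac_rfl

lemma pow_mul_prod_pow_sq_dvd {M : Type*} [CommMonoid M] (x : M) (t : ℕ) :
    x ^ t * (∏ i ∈ range t, x ^ i) ^ 2 ∣ ∏ i ∈ range (2 * t), x ^ i := by
  rw [prod_pow_eq_pow_sum, prod_pow_eq_pow_sum, ← pow_mul, ← pow_add]
  apply pow_dvd_pow
  induction t with
  | zero => simp
  | succ t ih =>
    rw [show 2 * (t + 1) = 2 * t + 1 + 1 by ring, sum_range_succ, sum_range_succ, sum_range_succ]
    omega

/-- A sequence satisfying the `r`-Lucas recursion interleaves copies of a Lucas sequence. -/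
lemma rLucas_succ_eq {R : Type*} [CommRing R] {r : ℕ} (hr : 0 < r) (x s t : R) (L : ℕ → R)
    (hL0 : L 0 = 0)
    (hL1 : ∀ i, 1 ≤ i → i ≤ r → L i = x ^ (i - 1))
    (hLrec : ∀ k, r < k → L k = s * L (k - r) + t * L (k - 2 * r)) (j : ℕ) :
    L (j + 1) = x ^ (j % r) * lucasSeq s t (j / r + 1) := by
  induction j using Nat.strong_induction_on with
  | _ j ih =>
    rcases lt_or_ge j r with hj | hj
    · rw [hL1 _ (by omega) (by omega), Nat.mod_eq_of_lt hj, Nat.div_eq_of_lt hj]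
      simp [lucasSeq]
    obtain ⟨k, rfl⟩ := Nat.exists_eq_add_of_le' hj
    rw [hLrec _ (by omega), show k + r + 1 - r = k + 1 by omega, ih k (by omega),
      Nat.add_mod_right, Nat.add_div_right k hr]
    rcases lt_or_ge k r with hk | hk
    · rw [show k + r + 1 - 2 * r = 0 by omega, hL0, Nat.div_eq_of_lt hk]
      simp only [lucasSeq]
      ring
    obtain ⟨l, rfl⟩ := Nat.exists_eq_add_of_le' hk
    rw [show l + r + r + 1 - 2 * r = l + 1 by omega, ih l (by omega),
      Nat.add_mod_right, Nat.add_div_right l hr]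
    simp only [lucasSeq]
    ring

/-- If `m mod r < r/2`, the `r`-Catalan analogue `Cat_r(m) = (1/{m+1}_r)·{2m}_r!/({m}_r!·{m}_r!)`
is a polynomial: `{m+1}_r · {m}_r! · {m}_r!` divides `{2m}_r!` in `ℤ[S]`. -/
theorem rCatalan_is_polynomial (r : ℕ) (hr : 0 < r) (m : ℕ) (hm : 2 * (m % r) < r)
    (L : ℕ → MvPolynomial ℕ ℤ)
    (hL0 : L 0 = 0)
    (hL1 : ∀ i, 1 ≤ i → i ≤ r → L i = X 1 ^ (i - 1))
    (hLrec : ∀ k, r < k → L k = X r * L (k - r) + X (2 * r) * L (k - 2 * r)) :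
    L (m + 1) * (∏ j ∈ Finset.range m, L (j + 1)) * (∏ j ∈ Finset.range m, L (j + 1))
      ∣ ∏ j ∈ Finset.range (2 * m), L (j + 1) := by
  simp only [rLucas_succ_eq hr (X 1) (X r) (X (2 * r)) L hL0 hL1 hLrec]
  set F := lucasSeq (X r : MvPolynomial ℕ ℤ) (X (2 * r)) with hF
  set x : MvPolynomial ℕ ℤ := X 1
  set q := m / r with hq
  set t := m % r with ht
  have hm_eq : m = q * r + t := (Nat.div_add_mod' m r).symm
  have h2m_eq : 2 * m = 2 * q * r + 2 * t := by rw [hm_eq]; ring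
  have hprod (q t : ℕ) (h : t ≤ r) :=
    prod_range_mod_mul_div (fun i => x ^ i) (fun k => F (k + 1)) q h
  rw [h2m_eq, hprod (2 * q) (2 * t) hm.le, hm_eq, hprod q t (by omega)]
  obtain ⟨c, hc⟩ := lucasSeq_mul_lucasFactorial_sq_dvd (X r : MvPolynomial ℕ ℤ) (X (2 * r)) q
  obtain ⟨d, hd⟩ := pow_mul_prod_pow_sq_dvd x t
  obtain ⟨e, he⟩ := Nat.exists_eq_add_of_le (show 2 * t + 1 ≤ r from hm)
  simp only [lucasFactorial, ← hF] at hc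
  rw [hc, hd, mul_pow (_ * _) c r, mul_pow (F (q + 1))]
  have hpow : F (q + 1) ^ r = F (q + 1) * F (q + 1) ^ t * F (q + 1) ^ t * F (q + 1) ^ e := by
    nth_rw 1 [he]
    ring
  rw [hpow]
  exact ⟨d * c ^ r * F (q + 1) ^ e * F (2 * q + 1) ^ (2 * t), by ring⟩
end

section
/- Let R = (r_1, …, r_ℓ) be a strictly decreasing sequence of positive integers with ℓ ≥ 1, let R' = (r_2, …, r_ℓ), and let m be a natural number. Then {m}_R! = ( {r_1}_{R'}! )^{⌊m/r_1⌋} · {m mod r_1}_{R'}! · φ_{r_1}( ∏_{j=0}^{r_1−1} {⌈(m ∸ j)/r_1⌉}! ), where the factorials inside φ_{r_1} are Lucas factorials and ∸ is truncated natural subtraction. (When r_1 does not divide m, m mod r_1 = ε_{r_1}(m), recovering the paper's formulation.) -/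
open MvPolynomial Finset

/-- The `R`-Lucas polynomials `{m}_R`: `{0}_R = 0`, `{m}_∅ = s₁^{m−1}` for `m ≥ 1`,
and `{m}_{r₁::R'} = {ε_{r₁}(m)}_{R'} · φ_{r₁}({⌈m/r₁⌉})` for `m ≥ 1`. -/
noncomputable def lucSeq : List ℕ → ℕ → MvPolynomial ℕ ℤ
  | _, 0 => 0
  | [], m + 1 => X 1 ^ m
  | r :: R', m + 1 => lucSeq R' (m % r + 1) * phi r (luc ((m + 1 + r - 1) / r))

/-- The `R`-Lucas factorial `{m}_R! = ∏_{j=1}^m {j}_R`. -/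
noncomputable def lucSeqFact (R : List ℕ) (m : ℕ) : MvPolynomial ℕ ℤ :=
  ∏ j ∈ Finset.range m, lucSeq R (j + 1)

theorem lucFact_succ (n : ℕ) : lucFact (n + 1) = lucFact n * luc (n + 1) :=
  Finset.prod_range_succ _ _

theorem lucSeqFact_succ (R : List ℕ) (m : ℕ) :
    lucSeqFact R (m + 1) = lucSeqFact R m * lucSeq R (m + 1) :=
  Finset.prod_range_succ _ _

theorem ceilDiv_succ_eq (m k : ℕ) :
    (m + 1 + (k + 1) - 1) / (k + 1) = (m - k + (k + 1) - 1) / (k + 1) + 1 := by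
  rcases le_or_gt k m with h | h
  · rw [show m + 1 + (k + 1) - 1 = (m - k + (k + 1) - 1) + (k + 1) by omega,
      Nat.add_div_right _ k.succ_pos]
  · rw [show m + 1 + (k + 1) - 1 = m + (k + 1) by omega, Nat.add_div_right _ k.succ_pos,
      Nat.div_eq_of_lt (by omega), Nat.div_eq_of_lt (by omega)]

/-- Raising `m` by one multiplies `∏_{j<r} {⌈(m ∸ j)/r⌉}!` by `{⌈(m+1)/r⌉}`. -/
theorem prod_lucFact_ceilDiv_succ {r : ℕ} (hr : 0 < r) (m : ℕ) :
    ∏ j ∈ Finset.range r, lucFact ((m + 1 - j + r - 1) / r)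
      = (∏ j ∈ Finset.range r, lucFact ((m - j + r - 1) / r)) * luc ((m + 1 + r - 1) / r) := by
  obtain ⟨k, rfl⟩ := Nat.exists_eq_add_one.mpr hr
  rw [Finset.prod_range_succ', Finset.prod_range_succ, mul_assoc, Nat.sub_zero,
    ceilDiv_succ_eq, lucFact_succ]
  simp only [Nat.add_sub_add_right]

theorem lucSeqFact_pow_mul_mod_succ {r : ℕ} (hr : 0 < r) (R : List ℕ) (m : ℕ) :
    lucSeqFact R r ^ ((m + 1) / r) * lucSeqFact R ((m + 1) % r)
      = lucSeqFact R r ^ (m / r) * lucSeqFact R (m % r) * lucSeq R (m % r + 1) := by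
  rw [mul_assoc, ← lucSeqFact_succ]
  have hm := Nat.div_add_mod m r
  rcases (Nat.succ_le_of_lt (Nat.mod_lt m hr)).lt_or_eq with h | h
  · have hs : m + 1 = m % r + 1 + r * (m / r) := by omega
    have hdiv : (m + 1) / r = m / r := by
      rw [hs, Nat.add_mul_div_left _ _ hr, Nat.div_eq_of_lt h, zero_add]
    have hmod : (m + 1) % r = m % r + 1 := by
      rw [hs, Nat.add_mul_mod_self_left, Nat.mod_eq_of_lt h]
    rw [hdiv, hmod]
  · rw [Nat.succ_eq_add_one] at h
    have hs : m + 1 = r * (m / r + 1) := by rw [mul_add, mul_one]; omega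
    have hdiv : (m + 1) / r = m / r + 1 := by rw [hs, Nat.mul_div_cancel_left _ hr]
    have hmod : (m + 1) % r = 0 := by rw [hs, Nat.mul_mod_right]
    rw [hdiv, hmod, h, pow_succ]
    simp [lucSeqFact]

/-- `{m}_{r::R'}! = ({r}_{R'}!)^{⌊m/r⌋} · {m mod r}_{R'}! · φ_r(∏_{j=0}^{r−1} {⌈(m ∸ j)/r⌉}!)`. -/
theorem lucSeq_factorial_eq (r : ℕ) (R' : List ℕ) (hpos : ∀ x ∈ r :: R', 0 < x)
    (hdec : (r :: R').Chain' (· > ·)) (m : ℕ) :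
    lucSeqFact (r :: R') m
      = lucSeqFact R' r ^ (m / r) * lucSeqFact R' (m % r)
        * phi r (∏ j ∈ Finset.range r, lucFact ((m - j + r - 1) / r)) := by
  have hr : 0 < r := hpos r List.mem_cons_self
  induction m with
  | zero =>
    have hceil : (r - 1) / r = 0 := Nat.div_eq_of_lt (by omega)
    simp [lucSeqFact, lucFact, hceil]
  | succ m ih =>
    rw [lucSeqFact_succ, ih, prod_lucFact_ceilDiv_succ hr, lucSeqFact_pow_mul_mod_succ hr,
      map_mul, lucSeq]
    ring
end
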